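/- arXiv:2404.01520 — 8 statements merged into one kernel-verified Lean document; each statement's English description precedes it below -/
import Mathlib

section
/- Let r ≥ 2 and let A, B be Hermitian r×r complex matrices such that AB − BA has rank 2. Then there exist vectors u, v ∈ ℂ^r with AB − BA = v u† − u v† and Im ⟨u, v⟩ = 0. -/
open Matrix

/-- If `A, B` are Hermitian `r × r` complex matrices such that `AB - BA` has rank 2, then
there exist vectors `u, v ∈ ℂ^r` with `AB - BA = v u† - u v†` and `Im ⟨u, v⟩ = 0`. -/
theorem exists_decomposition_of_rank_two (r : ℕ) (hr : 2 ≤ r)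
    (A B : Matrix (Fin r) (Fin r) ℂ) (hA : A.IsHermitian) (hB : B.IsHermitian)
    (hrank : (A * B - B * A).rank = 2) :
    ∃ u v : Fin r → ℂ,
      A * B - B * A = vecMulVec v (star u) - vecMulVec u (star v) ∧
      (∑ i, star (u i) * v i).im = 0 := by
  have htr : (A * B - B * A).trace = 0 := by
    rw [trace_sub, trace_mul_comm, sub_self]
  have hC : (A * B - B * A)ᴴ = -(A * B - B * A) := by
    rw [conjTranspose_sub, conjTranspose_mul, conjTranspose_mul, hA.eq, hB.eq, neg_sub]
  generalize A * B - B * A = C at *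
  suffices h : ∃ u v : Fin r → ℂ, C = vecMulVec v (star u) - vecMulVec u (star v) by
    obtain ⟨u, v, h⟩ := h
    refine ⟨u, v, h, ?_⟩
    have h1 : C.trace = (∑ i, star (u i) * v i) - star (∑ i, star (u i) * v i) := by
      rw [h, trace_sub]
      simp [trace, vecMulVec_apply, mul_comm]
    rw [htr] at h1
    have h2 := congrArg Complex.im h1
    simp only [Complex.sub_im, Complex.zero_im, Complex.star_def, Complex.conj_im] at h2 ⊢
    linarith
  have hH : (Complex.I • C).IsHermitian := by
    unfold IsHermitian
    rw [conjTranspose_smul, hC]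
    simp
  have hrk : (Complex.I • C).rank = 2 := by
    rw [← hrank]
    apply le_antisymm
    · have := rank_mul_le_right (Complex.I • (1 : Matrix (Fin r) (Fin r) ℂ)) C
      simpa using this
    · have := rank_mul_le_right ((-Complex.I) • (1 : Matrix (Fin r) (Fin r) ℂ)) (Complex.I • C)
      simpa [smul_smul] using this
  have htH : (Complex.I • C).trace = 0 := by rw [trace_smul, htr, smul_zero]
  rw [hH.rank_eq_card_non_zero_eigs, Fintype.card_subtype, Finset.card_eq_two] at hrk
  obtain ⟨k, l, hkl, hs⟩ := hrk
  have h0 : ∀ m, m ≠ k ∧ m ≠ l → hH.eigenvalues m = 0 := by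
    intro m hm
    by_contra hne
    have : m ∈ ({k, l} : Finset (Fin r)) := by rw [← hs]; simp [hne]
    simp at this
    tauto
  rw [hH.trace_eq_sum_eigenvalues, Fintype.sum_eq_add k l hkl
    (fun m hm => by rw [h0 m hm]; simp)] at htH
  have hent : ∀ i j, (Complex.I • C) i j = ∑ m, (hH.eigenvectorUnitary : Matrix _ _ ℂ) i m *
      (hH.eigenvalues m : ℂ) * star ((hH.eigenvectorUnitary : Matrix _ _ ℂ) j m) := by
    intro i j
    conv_lhs => rw [hH.spectral_theorem, Unitary.conjStarAlgAut_apply]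
    rw [mul_apply]
    simp [mul_diagonal, star_apply]
  generalize (hH.eigenvectorUnitary : Matrix (Fin r) (Fin r) ℂ) = U at hent
  generalize hH.eigenvalues = e at *
  have hl : ((e l : ℝ) : ℂ) = -(e k : ℂ) := by
    simpa using eq_neg_of_add_eq_zero_right htH
  refine ⟨fun i => U i k - U i l, fun i => (-Complex.I * e k / 2) * (U i k + U i l), ?_⟩
  ext i j
  have h1 := hent i j
  rw [Fintype.sum_eq_add k l hkl (fun m hm => by rw [h0 m hm]; simp), hl] at h1
  have h2 : C i j = -Complex.I * (Complex.I • C) i j := by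
    simp [← mul_assoc]
  rw [h2, h1]
  simp [vecMulVec_apply]
  ring
end

section
/- Let r ≥ 1, let A, B be Hermitian r×r complex matrices, ℓ1, ℓ2 ∈ ℂ^r, and k1, k2 ∈ ℝ. Define the (r+1)×(r+1) Hermitian block matrices 𝓛1 = [[A, ℓ1],[ℓ1†, k1]] and 𝓛2 = [[B, ℓ2],[ℓ2†, k2]] (top-left r×r block A resp. B, last column ℓ_j, last row ℓ_j†, bottom-right entry k_j). Then 𝓛1 𝓛2 = 𝓛2 𝓛1 if and only if AB − BA = ℓ2 ℓ1† − ℓ1 ℓ2† and (A − k1·I) ℓ2 = (B − k2·I) ℓ1. -/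
open Matrix

/-- For Hermitian `A, B`, vectors `ℓ1, ℓ2` and reals `k1, k2`, the bordered Hermitian
matrices `𝓛j = [[A, ℓj],[ℓj†, kj]]` commute iff `AB - BA = ℓ2 ℓ1† - ℓ1 ℓ2†` and
`(A - k1 I) ℓ2 = (B - k2 I) ℓ1`. -/
theorem bordered_commute_iff (r : ℕ) (hr : 1 ≤ r)
    (A B : Matrix (Fin r) (Fin r) ℂ) (hA : A.IsHermitian) (hB : B.IsHermitian)
    (ℓ1 ℓ2 : Fin r → ℂ) (k1 k2 : ℝ) :
    (fromBlocks A (Matrix.of fun p (_ : Fin 1) => ℓ1 p)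
        (Matrix.of fun (_ : Fin 1) q => star (ℓ1 q)) (Matrix.of fun _ _ => (k1 : ℂ)) *
      fromBlocks B (Matrix.of fun p (_ : Fin 1) => ℓ2 p)
        (Matrix.of fun (_ : Fin 1) q => star (ℓ2 q)) (Matrix.of fun _ _ => (k2 : ℂ)) =
     fromBlocks B (Matrix.of fun p (_ : Fin 1) => ℓ2 p)
        (Matrix.of fun (_ : Fin 1) q => star (ℓ2 q)) (Matrix.of fun _ _ => (k2 : ℂ)) *
      fromBlocks A (Matrix.of fun p (_ : Fin 1) => ℓ1 p)
        (Matrix.of fun (_ : Fin 1) q => star (ℓ1 q)) (Matrix.of fun _ _ => (k1 : ℂ)))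
    ↔ (A * B - B * A = vecMulVec ℓ2 (star ℓ1) - vecMulVec ℓ1 (star ℓ2) ∧
       (A - (k1 : ℂ) • 1) *ᵥ ℓ2 = (B - (k2 : ℂ) • 1) *ᵥ ℓ1) := by
  rw [fromBlocks_multiply, fromBlocks_multiply, fromBlocks_inj]
  have e11 : (A * B + (Matrix.of fun p (_ : Fin 1) => ℓ1 p) *
        (Matrix.of fun (_ : Fin 1) q => star (ℓ2 q)) =
      B * A + (Matrix.of fun p (_ : Fin 1) => ℓ2 p) *
        (Matrix.of fun (_ : Fin 1) q => star (ℓ1 q))) ↔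
      A * B - B * A = vecMulVec ℓ2 (star ℓ1) - vecMulVec ℓ1 (star ℓ2) := by
    have h1 : ∀ u v : Fin r → ℂ, (Matrix.of fun p (_ : Fin 1) => u p) *
        (Matrix.of fun (_ : Fin 1) q => star (v q)) = vecMulVec u (star v) := by
      intro u v
      ext i j
      simp [Matrix.mul_apply, vecMulVec_apply]
    rw [h1, h1, sub_eq_sub_iff_add_eq_add, add_comm (vecMulVec ℓ2 (star ℓ1))]
  have e12 : (A * (Matrix.of fun p (_ : Fin 1) => ℓ2 p) +
        (Matrix.of fun p (_ : Fin 1) => ℓ1 p) * (Matrix.of fun (_ _ : Fin 1) => (k2 : ℂ)) =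
      B * (Matrix.of fun p (_ : Fin 1) => ℓ1 p) +
        (Matrix.of fun p (_ : Fin 1) => ℓ2 p) * (Matrix.of fun (_ _ : Fin 1) => (k1 : ℂ))) ↔
      ∀ i, ∑ j, A i j * ℓ2 j + ℓ1 i * k2 = ∑ j, B i j * ℓ1 j + ℓ2 i * k1 := by
    rw [← Matrix.ext_iff]
    simp [Matrix.mul_apply]
  have e12' : ((A - (k1 : ℂ) • 1) *ᵥ ℓ2 = (B - (k2 : ℂ) • 1) *ᵥ ℓ1) ↔
      ∀ i, ∑ j, A i j * ℓ2 j + ℓ1 i * k2 = ∑ j, B i j * ℓ1 j + ℓ2 i * k1 := by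
    rw [funext_iff]
    refine forall_congr' fun i => ?_
    simp only [sub_mulVec, smul_mulVec, one_mulVec, Pi.sub_apply, Pi.smul_apply, smul_eq_mul]
    simp only [mulVec, dotProduct]
    constructor <;> intro h <;> linear_combination h
  rw [e11, e12, e12']
  refine ⟨fun h => ⟨h.1, h.2.1⟩, fun ⟨h1, h2⟩ => ⟨h1, h2, ?_, ?_⟩⟩
  · ext a q
    have h := congrArg star (h2 q)
    simp only [star_add, star_sum, star_mul, hA.apply, hB.apply] at h
    simp only [Matrix.add_apply, Matrix.mul_apply, Matrix.of_apply, Fin.sum_univ_one]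
    have c : ∀ k : ℝ, star (k : ℂ) = k := fun k => Complex.conj_ofReal k
    rw [c, c] at h
    linear_combination -h
  · ext a b
    have h := congrArg Matrix.trace h1
    rw [Matrix.trace_sub, Matrix.trace_mul_comm, sub_self, Matrix.trace_sub] at h
    simp only [Matrix.trace, Matrix.diag_apply, vecMulVec_apply, Pi.star_apply] at h
    simp only [Matrix.add_apply, Matrix.mul_apply, Matrix.of_apply, Fin.sum_univ_one]
    simp only [mul_comm (star _)]
    linear_combination -h
end

section
/- Let r ≥ 1, let A, B be Hermitian r×r complex matrices, and let ℓ1, ℓ2 ∈ ℂ^r be linearly independent. The following are equivalent: (i) there exist e ∈ ℕ and Hermitian (r+1+e)×(r+1+e) complex matrices 𝓛̃1, 𝓛̃2 such that, indexing rows and columns from 0, for j = 1, 2 the entries (𝓛̃j)_{pq} for p,q < r form the matrix A (resp. B), the entries (𝓛̃j)_{p r} for p < r equal (ℓ_j)_p, the entries (𝓛̃j)_{p m} for p < r and m > r are all 0, and 𝓛̃1 𝓛̃2 = 𝓛̃2 𝓛̃1; (ii) AB − BA = ℓ2 ℓ1† − ℓ1 ℓ2† and there exist k1, k2 ∈ ℝ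 with (A − k1·I) ℓ2 = (B − k2·I) ℓ1. -/
open Matrix

theorem sum_split_ext (r e : ℕ) (f : Fin (r + 1 + e) → ℂ)
    (h : ∀ m : Fin (r + 1 + e), r < (m : ℕ) → f m = 0)
    (h1 : r ≤ r + 1 + e) (h2 : r < r + 1 + e) :
    ∑ m, f m = (∑ p : Fin r, f (Fin.castLE h1 p)) + f ⟨r, h2⟩ := by
  rw [Fin.sum_univ_add, Fin.sum_univ_castSucc]
  have h0 : ∑ i : Fin e, f (Fin.natAdd (r + 1) i) = 0 := by
    apply Finset.sum_eq_zero
    intro i _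
    apply h
    simp only [Fin.val_natAdd]
    omega
  rw [h0, add_zero]
  rfl

/-- The bordered matrix. -/
noncomputable def bordered (r : ℕ) (A : Matrix (Fin r) (Fin r) ℂ) (l : Fin r → ℂ) (k : ℝ) :
    Matrix (Fin r ⊕ Fin 1) (Fin r ⊕ Fin 1) ℂ :=
  fromBlocks A (Matrix.of fun p _ => l p) (Matrix.of fun _ p => star (l p))
    (Matrix.of fun _ _ => (k : ℂ))

theorem bordered_herm (r : ℕ) (A : Matrix (Fin r) (Fin r) ℂ) (hA : A.IsHermitian)
    (l : Fin r → ℂ) (k : ℝ) : (bordered r A l k).IsHermitian := by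
  unfold bordered
  refine IsHermitian.fromBlocks hA ?_ ?_
  · ext i j
    simp
  · ext i j
    simp

theorem bordered_comm (r : ℕ) (A B : Matrix (Fin r) (Fin r) ℂ)
    (hA : A.IsHermitian) (hB : B.IsHermitian) (l1 l2 : Fin r → ℂ) (k1 k2 : ℝ)
    (hc : A * B - B * A = vecMulVec l2 (star l1) - vecMulVec l1 (star l2))
    (hk : (A - (k1 : ℂ) • 1) *ᵥ l2 = (B - (k2 : ℂ) • 1) *ᵥ l1) :
    bordered r A l1 k1 * bordered r B l2 k2 = bordered r B l2 k2 * bordered r A l1 k1 := by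
  have hk' : ∀ p, (∑ q, A p q * l2 q) + l1 p * k2 = (∑ q, B p q * l1 q) + l2 p * k1 := by
    intro p
    have := congrFun hk p
    simp only [sub_mulVec, smul_mulVec, one_mulVec, Pi.sub_apply, Pi.smul_apply, smul_eq_mul] at this
    simp only [mulVec, dotProduct] at this
    linear_combination this
  have ht := congrArg trace hc
  simp only [trace_sub, trace_mul_comm A B, sub_self, trace_vecMulVec, dotProduct,
    Pi.star_apply] at ht
  unfold bordered
  rw [fromBlocks_multiply, fromBlocks_multiply, fromBlocks_inj]
  refine ⟨?_, ?_, ?_, ?_⟩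
  · ext p q
    have := congrFun (congrFun hc p) q
    simp only [Matrix.sub_apply, vecMulVec_apply, Pi.star_apply] at this
    simp [mul_apply] at this ⊢
    linear_combination this
  · ext p q
    simpa [mul_apply] using hk' p
  · ext q p
    have := congrArg star (hk' p)
    simp only [star_add, star_sum, star_mul'] at this
    have ea : ∀ i, star (A p i) = A i p := fun i => hA.apply i p
    have eb : ∀ i, star (B p i) = B i p := fun i => hB.apply i p
    simp only [ea, eb] at this
    simp [mul_apply] at this ⊢
    simp only [mul_comm] at this ⊢
    linear_combination -this
  · ext p q
    simp [mul_apply] at ht ⊢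
    simp only [mul_comm] at ht ⊢
    linear_combination -ht

/-- Commuting Hermitian extensions on an extended Hilbert space exist iff the support
commutativity condition and the span condition already hold. -/
theorem extension_commute_iff (r : ℕ) (hr : 1 ≤ r)
    (A B : Matrix (Fin r) (Fin r) ℂ) (hA : A.IsHermitian) (hB : B.IsHermitian)
    (ℓ1 ℓ2 : Fin r → ℂ) (hli : LinearIndependent ℂ ![ℓ1, ℓ2]) :
    (∃ (e : ℕ) (L1 L2 : Matrix (Fin (r + 1 + e)) (Fin (r + 1 + e)) ℂ),
      L1.IsHermitian ∧ L2.IsHermitian ∧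
      (∀ p q : Fin r, L1 (Fin.castLE (by omega) p) (Fin.castLE (by omega) q) = A p q) ∧
      (∀ p q : Fin r, L2 (Fin.castLE (by omega) p) (Fin.castLE (by omega) q) = B p q) ∧
      (∀ p : Fin r, L1 (Fin.castLE (by omega) p) ⟨r, by omega⟩ = ℓ1 p) ∧
      (∀ p : Fin r, L2 (Fin.castLE (by omega) p) ⟨r, by omega⟩ = ℓ2 p) ∧
      (∀ (p : Fin r) (m : Fin (r + 1 + e)), r < (m : ℕ) →
        L1 (Fin.castLE (by omega) p) m = 0) ∧
      (∀ (p : Fin r) (m : Fin (r + 1 + e)), r < (m : ℕ) →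
        L2 (Fin.castLE (by omega) p) m = 0) ∧
      L1 * L2 = L2 * L1)
    ↔ (A * B - B * A = vecMulVec ℓ2 (star ℓ1) - vecMulVec ℓ1 (star ℓ2) ∧
       ∃ k1 k2 : ℝ, (A - (k1 : ℂ) • 1) *ᵥ ℓ2 = (B - (k2 : ℂ) • 1) *ᵥ ℓ1) := by
  constructor
  · rintro ⟨e, L1, L2, h1, h2, hA1, hB2, hl1, hl2, z1, z2, hc⟩
    have hl1s : ∀ p : Fin r, L1 ⟨r, by omega⟩ (Fin.castLE (by omega) p) = star (ℓ1 p) := by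
      intro p
      rw [← hl1 p, h1.apply]
    have hl2s : ∀ p : Fin r, L2 ⟨r, by omega⟩ (Fin.castLE (by omega) p) = star (ℓ2 p) := by
      intro p
      rw [← hl2 p, h2.apply]
    have key : ∀ (p : Fin r) (x : Fin (r + 1 + e)),
        (∑ q : Fin r, A p q * L2 (Fin.castLE (by omega) q) x) + ℓ1 p * L2 ⟨r, by omega⟩ x
        = (∑ q : Fin r, B p q * L1 (Fin.castLE (by omega) q) x) + ℓ2 p * L1 ⟨r, by omega⟩ x := by
      intro p x
      have := congrFun (congrFun hc (Fin.castLE (by omega) p)) x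
      rw [mul_apply, mul_apply,
        sum_split_ext r e _ (fun m hm => by rw [z1 p m hm, zero_mul]) (by omega) (by omega),
        sum_split_ext r e _ (fun m hm => by rw [z2 p m hm, zero_mul]) (by omega) (by omega)] at this
      simpa only [hA1, hB2, hl1, hl2] using this
    refine ⟨?_, (L1 ⟨r, by omega⟩ ⟨r, by omega⟩).re, (L2 ⟨r, by omega⟩ ⟨r, by omega⟩).re, ?_⟩
    · ext p q
      have := key p (Fin.castLE (by omega) q)
      simp only [hA1, hB2, hl1s, hl2s] at this
      simp only [Matrix.sub_apply, mul_apply, vecMulVec_apply, Pi.star_apply]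
      linear_combination this
    · have e1 : ((L1 ⟨r, by omega⟩ ⟨r, by omega⟩).re : ℂ) = L1 ⟨r, by omega⟩ ⟨r, by omega⟩ :=
        Complex.conj_eq_iff_re.mp (h1.apply _ _)
      have e2 : ((L2 ⟨r, by omega⟩ ⟨r, by omega⟩).re : ℂ) = L2 ⟨r, by omega⟩ ⟨r, by omega⟩ :=
        Complex.conj_eq_iff_re.mp (h2.apply _ _)
      rw [e1, e2]
      ext p
      have := key p ⟨r, by omega⟩
      simp only [hl1, hl2] at this
      simp only [sub_mulVec, smul_mulVec, one_mulVec, Pi.sub_apply, Pi.smul_apply, smul_eq_mul]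
      simp only [mulVec, dotProduct]
      linear_combination this
  · rintro ⟨hc, k1, k2, hk⟩
    have ecast : ∀ p : Fin r, (finSumFinEquiv (m := r) (n := 1)).symm
        (Fin.castLE (by omega) p) = Sum.inl p := by
      intro p
      rw [Equiv.symm_apply_eq]
      rfl
    have elast : (finSumFinEquiv (m := r) (n := 1)).symm ⟨r, by omega⟩ = Sum.inr 0 := by
      rw [Equiv.symm_apply_eq]
      rfl
    refine ⟨0, (bordered r A ℓ1 k1).submatrix (finSumFinEquiv (m := r) (n := 1)).symm
        (finSumFinEquiv (m := r) (n := 1)).symm,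
      (bordered r B ℓ2 k2).submatrix (finSumFinEquiv (m := r) (n := 1)).symm
        (finSumFinEquiv (m := r) (n := 1)).symm,
      (bordered_herm r A hA ℓ1 k1).submatrix _, (bordered_herm r B hB ℓ2 k2).submatrix _,
      ?_, ?_, ?_, ?_, ?_, ?_, ?_⟩
    · intro p q
      exact congrArg₂ (bordered r A ℓ1 k1) (ecast p) (ecast q)
    · intro p q
      exact congrArg₂ (bordered r B ℓ2 k2) (ecast p) (ecast q)
    · intro p
      exact congrArg₂ (bordered r A ℓ1 k1) (ecast p) elast
    · intro p
      exact congrArg₂ (bordered r B ℓ2 k2) (ecast p) elast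
    · intro p m hm
      omega
    · intro p m hm
      omega
    · have := bordered_comm r A B hA hB ℓ1 ℓ2 k1 k2 hc hk
      have h3 := congrArg (fun M => M.submatrix (finSumFinEquiv (m := r) (n := 1)).symm
        (finSumFinEquiv (m := r) (n := 1)).symm) this
      simp only [← submatrix_mul_equiv _ _ _ (finSumFinEquiv (m := r) (n := 1)).symm _] at h3
      exact h3
end

section
/- Let A, B be Hermitian 2×2 complex matrices and ℓ1, ℓ2 ∈ ℂ² linearly independent. If AB − BA = ℓ2 ℓ1† − ℓ1 ℓ2†, then there exist k1, k2 ∈ ℝ with (A − k1·I) ℓ2 = (B − k2·I) ℓ1; consequently the 3×3 Hermitian block matrices 𝓛1 = [[A, ℓ1],[ℓ1†, k1]] and 𝓛2 = [[B, ℓ2],[ℓ2†, k2]] commute. -/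
open Matrix

/-- Rank-2 case of Theorem 1: for Hermitian `2 × 2` matrices `A, B` and linearly
independent `ℓ1, ℓ2 ∈ ℂ²` with `AB - BA = ℓ2 ℓ1† - ℓ1 ℓ2†`, there exist reals
`k1, k2` with `(A - k1 I) ℓ2 = (B - k2 I) ℓ1`, and the resulting bordered `3 × 3`
Hermitian matrices commute. -/
theorem rank_two_case (A B : Matrix (Fin 2) (Fin 2) ℂ)
    (hA : A.IsHermitian) (hB : B.IsHermitian)
    (ℓ1 ℓ2 : Fin 2 → ℂ) (hli : LinearIndependent ℂ ![ℓ1, ℓ2])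
    (h : A * B - B * A = vecMulVec ℓ2 (star ℓ1) - vecMulVec ℓ1 (star ℓ2)) :
    ∃ k1 k2 : ℝ,
      (A - (k1 : ℂ) • 1) *ᵥ ℓ2 = (B - (k2 : ℂ) • 1) *ᵥ ℓ1 ∧
      fromBlocks A (Matrix.of fun p (_ : Fin 1) => ℓ1 p)
          (Matrix.of fun (_ : Fin 1) q => star (ℓ1 q)) (Matrix.of fun _ _ => (k1 : ℂ)) *
        fromBlocks B (Matrix.of fun p (_ : Fin 1) => ℓ2 p)
          (Matrix.of fun (_ : Fin 1) q => star (ℓ2 q)) (Matrix.of fun _ _ => (k2 : ℂ)) =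
      fromBlocks B (Matrix.of fun p (_ : Fin 1) => ℓ2 p)
          (Matrix.of fun (_ : Fin 1) q => star (ℓ2 q)) (Matrix.of fun _ _ => (k2 : ℂ)) *
        fromBlocks A (Matrix.of fun p (_ : Fin 1) => ℓ1 p)
          (Matrix.of fun (_ : Fin 1) q => star (ℓ1 q)) (Matrix.of fun _ _ => (k1 : ℂ)) := by
  have hA00 : star (A 0 0) = A 0 0 := hA.apply 0 0
  have hA11 : star (A 1 1) = A 1 1 := hA.apply 1 1
  have hA01 : star (A 0 1) = A 1 0 := hA.apply 1 0
  have hA10 : star (A 1 0) = A 0 1 := hA.apply 0 1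
  have hB00 : star (B 0 0) = B 0 0 := hB.apply 0 0
  have hB11 : star (B 1 1) = B 1 1 := hB.apply 1 1
  have hB01 : star (B 0 1) = B 1 0 := hB.apply 1 0
  have hB10 : star (B 1 0) = B 0 1 := hB.apply 0 1
  have hd : ℓ1 0 * ℓ2 1 - ℓ1 1 * ℓ2 0 ≠ 0 := by
    have h1 := (Matrix.linearIndependent_rows_iff_isUnit (A := Matrix.of ![ℓ1, ℓ2])).1 hli
    rw [Matrix.isUnit_iff_isUnit_det, isUnit_iff_ne_zero, Matrix.det_fin_two] at h1
    simpa using h1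
  have h00 := congrFun (congrFun h 0) 0
  have h01 := congrFun (congrFun h 0) 1
  have h10 := congrFun (congrFun h 1) 0
  have h11 := congrFun (congrFun h 1) 1
  simp only [Matrix.sub_apply, Matrix.mul_apply, Fin.sum_univ_two, vecMulVec_apply,
    Pi.star_apply] at h00 h01 h10 h11
  -- the three trace identities
  have t0 : star (ℓ1 0) * ℓ2 0 + star (ℓ1 1) * ℓ2 1
      = star (ℓ2 0) * ℓ1 0 + star (ℓ2 1) * ℓ1 1 := by
    linear_combination -h00 - h11
  have tA : star (ℓ1 0) * (A 0 0 * ℓ2 0 + A 0 1 * ℓ2 1)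
        + star (ℓ1 1) * (A 1 0 * ℓ2 0 + A 1 1 * ℓ2 1)
      = star (ℓ2 0) * (A 0 0 * ℓ1 0 + A 0 1 * ℓ1 1)
        + star (ℓ2 1) * (A 1 0 * ℓ1 0 + A 1 1 * ℓ1 1) := by
    linear_combination -h00 * A 0 0 - h01 * A 1 0 - h10 * A 0 1 - h11 * A 1 1
  have tB : star (ℓ1 0) * (B 0 0 * ℓ2 0 + B 0 1 * ℓ2 1)
        + star (ℓ1 1) * (B 1 0 * ℓ2 0 + B 1 1 * ℓ2 1)
      = star (ℓ2 0) * (B 0 0 * ℓ1 0 + B 0 1 * ℓ1 1)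
        + star (ℓ2 1) * (B 1 0 * ℓ1 0 + B 1 1 * ℓ1 1) := by
    linear_combination -h00 * B 0 0 - h01 * B 1 0 - h10 * B 0 1 - h11 * B 1 1
  obtain ⟨w0, hw0⟩ : ∃ w, w = A 0 0 * ℓ2 0 + A 0 1 * ℓ2 1 - (B 0 0 * ℓ1 0 + B 0 1 * ℓ1 1) :=
    ⟨_, rfl⟩
  obtain ⟨w1, hw1⟩ : ∃ w, w = A 1 0 * ℓ2 0 + A 1 1 * ℓ2 1 - (B 1 0 * ℓ1 0 + B 1 1 * ℓ1 1) :=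
    ⟨_, rfl⟩
  have sw0 : star w0 = A 0 0 * star (ℓ2 0) + A 1 0 * star (ℓ2 1)
      - (B 0 0 * star (ℓ1 0) + B 1 0 * star (ℓ1 1)) := by
    rw [hw0]; simp only [star_sub, star_add, star_mul', hA00, hA01, hB00, hB01]
  have sw1 : star w1 = A 0 1 * star (ℓ2 0) + A 1 1 * star (ℓ2 1)
      - (B 0 1 * star (ℓ1 0) + B 1 1 * star (ℓ1 1)) := by
    rw [hw1]; simp only [star_sub, star_add, star_mul', hA10, hA11, hB10, hB11]
  have r1 : star (ℓ1 0) * w0 + star (ℓ1 1) * w1 = ℓ1 0 * star w0 + ℓ1 1 * star w1 := by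
    rw [sw0, sw1, hw0, hw1]; linear_combination tA
  have r2 : star (ℓ2 0) * w0 + star (ℓ2 1) * w1 = ℓ2 0 * star w0 + ℓ2 1 * star w1 := by
    rw [sw0, sw1, hw0, hw1]; linear_combination tB
  have hd' : star (ℓ1 0) * star (ℓ2 1) - star (ℓ1 1) * star (ℓ2 0) ≠ 0 := by
    have := star_ne_zero.2 hd
    simpa only [star_sub, star_mul'] using this
  obtain ⟨k1, hk1⟩ : ∃ k : ℝ, (k : ℂ) = (ℓ1 0 * w1 - ℓ1 1 * w0) / (ℓ1 0 * ℓ2 1 - ℓ1 1 * ℓ2 0) := by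
    have : star ((ℓ1 0 * w1 - ℓ1 1 * w0) / (ℓ1 0 * ℓ2 1 - ℓ1 1 * ℓ2 0))
        = (ℓ1 0 * w1 - ℓ1 1 * w0) / (ℓ1 0 * ℓ2 1 - ℓ1 1 * ℓ2 0) := by
      simp only [star_div₀, star_sub, star_mul']
      rw [div_eq_div_iff hd' hd]
      linear_combination (-(star (ℓ1 0) * ℓ1 0 + star (ℓ1 1) * ℓ1 1)) * r2
        + (star (ℓ2 0) * ℓ1 0 + star (ℓ2 1) * ℓ1 1) * r1
        - (ℓ1 0 * star w0 + ℓ1 1 * star w1) * t0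
    obtain ⟨k, hk⟩ := Complex.conj_eq_iff_real.1 this
    exact ⟨k, hk.symm⟩
  obtain ⟨k2, hk2⟩ : ∃ k : ℝ, (k : ℂ) = (ℓ2 0 * w1 - ℓ2 1 * w0) / (ℓ1 0 * ℓ2 1 - ℓ1 1 * ℓ2 0) := by
    have : star ((ℓ2 0 * w1 - ℓ2 1 * w0) / (ℓ1 0 * ℓ2 1 - ℓ1 1 * ℓ2 0))
        = (ℓ2 0 * w1 - ℓ2 1 * w0) / (ℓ1 0 * ℓ2 1 - ℓ1 1 * ℓ2 0) := by
      simp only [star_div₀, star_sub, star_mul']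
      rw [div_eq_div_iff hd' hd]
      linear_combination (star (ℓ2 0) * ℓ2 0 + star (ℓ2 1) * ℓ2 1) * r1
        - (star (ℓ1 0) * ℓ2 0 + star (ℓ1 1) * ℓ2 1) * r2
        - (ℓ2 0 * star w0 + ℓ2 1 * star w1) * t0
    obtain ⟨k, hk⟩ := Complex.conj_eq_iff_real.1 this
    exact ⟨k, hk.symm⟩
  have e0 : w0 = k1 * ℓ2 0 - k2 * ℓ1 0 := by
    rw [hk1, hk2, div_mul_eq_mul_div, div_mul_eq_mul_div, ← sub_div, eq_div_iff hd]; ring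
  have e1 : w1 = k1 * ℓ2 1 - k2 * ℓ1 1 := by
    rw [hk1, hk2, div_mul_eq_mul_div, div_mul_eq_mul_div, ← sub_div, eq_div_iff hd]; ring
  have f0 : star w0 = k1 * star (ℓ2 0) - k2 * star (ℓ1 0) := by
    rw [e0]; simp
  have f1 : star w1 = k1 * star (ℓ2 1) - k2 * star (ℓ1 1) := by
    rw [e1]; simp
  refine ⟨k1, k2, ?_, ?_⟩
  · ext i
    fin_cases i
    · simp [Matrix.mulVec, dotProduct, Fin.sum_univ_two, Matrix.sub_apply]
      linear_combination e0 - hw0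
    · simp [Matrix.mulVec, dotProduct, Fin.sum_univ_two, Matrix.sub_apply]
      linear_combination e1 - hw1
  · rw [fromBlocks_multiply, fromBlocks_multiply]
    congr 1
    · ext i j
      have := congrFun (congrFun h i) j
      simp only [Matrix.sub_apply, vecMulVec_apply, Pi.star_apply] at this
      simp only [Matrix.add_apply, Matrix.mul_apply (M := Matrix.of _), Finset.univ_unique,
        Finset.sum_singleton, Matrix.of_apply]
      linear_combination this
    · ext i j
      fin_cases i
      · simp [Matrix.mul_apply, Fin.sum_univ_two]
        linear_combination e0 - hw0
      · simp [Matrix.mul_apply, Fin.sum_univ_two]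
        linear_combination e1 - hw1
    · ext i j
      simp only [← starRingEnd_apply] at *
      fin_cases j
      · simp [Matrix.mul_apply, Fin.sum_univ_two]
        linear_combination sw0 - f0
      · simp [Matrix.mul_apply, Fin.sum_univ_two]
        linear_combination sw1 - f1
    · ext i j
      simp only [← starRingEnd_apply] at *
      simp [Matrix.mul_apply, Fin.sum_univ_two]
      linear_combination t0
end

section
/- Let r, m ∈ ℕ, n = r + m, let c > 0 be real, and let S be the n×n complex matrix c·P, where P is the diagonal matrix with 1 in the first r diagonal entries and 0 elsewhere. Let D and L be Hermitian n×n complex matrices (rows and columns indexed from 0). Then D = (1/2)(S L + L S) holds if and only if: D_{pq} = 0 for all p, q ≥ r; L_{pq} = D_{pq}/c for all p, q < r; and L_{pq} = 2·D_{pq}/c for all p < r ≤ q. -/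
open Matrix

/-- For a state `S = c·P`, with `P` the projection onto the first `r` coordinates, the SLD
equation `D = (1/2)(SL + LS)` determines the support and support-kernel blocks of `L`,
leaves the kernel block of `L` free, and forces the kernel block of `D` to vanish. -/
theorem sld_equation_characterization (r m : ℕ) (c : ℝ) (hc : 0 < c)
    (D L : Matrix (Fin (r + m)) (Fin (r + m)) ℂ)
    (hD : D.IsHermitian) (hL : L.IsHermitian) :
    (D = (1 / 2 : ℂ) •
        ((c : ℂ) • (Matrix.of fun p q : Fin (r + m) =>
            if p = q ∧ (p : ℕ) < r then (1 : ℂ) else 0) * L +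
         L * (c : ℂ) • (Matrix.of fun p q : Fin (r + m) =>
            if p = q ∧ (p : ℕ) < r then (1 : ℂ) else 0)))
    ↔ ((∀ p q : Fin (r + m), r ≤ (p : ℕ) → r ≤ (q : ℕ) → D p q = 0) ∧
       (∀ p q : Fin (r + m), (p : ℕ) < r → (q : ℕ) < r → L p q = D p q / (c : ℂ)) ∧
       (∀ p q : Fin (r + m), (p : ℕ) < r → r ≤ (q : ℕ) → L p q = 2 * D p q / (c : ℂ))) := by
  have hc' : (c : ℂ) ≠ 0 := by exact_mod_cast hc.ne'
  have hP : (Matrix.of fun p q : Fin (r + m) =>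
      if p = q ∧ (p : ℕ) < r then (1 : ℂ) else 0)
      = Matrix.diagonal fun p : Fin (r + m) => if (p : ℕ) < r then (1 : ℂ) else 0 := by
    ext p q
    by_cases h : p = q
    · subst h; simp
    · simp [h]
  rw [hP, ← Matrix.ext_iff]
  have key : ∀ p q : Fin (r + m), ((1 / 2 : ℂ) •
        ((c : ℂ) • (Matrix.diagonal fun p : Fin (r + m) =>
            if (p : ℕ) < r then (1 : ℂ) else 0) * L +
         L * (c : ℂ) • (Matrix.diagonal fun p : Fin (r + m) =>
            if (p : ℕ) < r then (1 : ℂ) else 0))) p q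
      = (1 / 2 : ℂ) * ((c : ℂ) * ((if (p : ℕ) < r then (1 : ℂ) else 0) * L p q)
        + (c : ℂ) * (L p q * (if (q : ℕ) < r then (1 : ℂ) else 0))) := by
    intro p q
    rw [Matrix.smul_apply, Matrix.add_apply, Matrix.smul_mul, Matrix.mul_smul,
      Matrix.smul_apply, Matrix.smul_apply, Matrix.diagonal_mul, Matrix.mul_diagonal]
    simp only [smul_eq_mul]
  simp only [key]
  constructor
  · intro h
    refine ⟨fun p q hp hq => ?_, fun p q hp hq => ?_, fun p q hp hq => ?_⟩
    · rw [h p q, if_neg (not_lt.mpr hp), if_neg (not_lt.mpr hq)]; ring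
    · rw [h p q, if_pos hp, if_pos hq]; field_simp; ring
    · rw [h p q, if_pos hp, if_neg (not_lt.mpr hq)]; field_simp; ring
  · rintro ⟨h0, h1, h2⟩ p q
    by_cases hp : (p : ℕ) < r <;> by_cases hq : (q : ℕ) < r
    · rw [if_pos hp, if_pos hq, h1 p q hp hq]; field_simp; ring
    · rw [if_pos hp, if_neg hq, h2 p q hp (not_lt.mp hq)]; field_simp; ring
    · have e : L p q = 2 * D p q / (c : ℂ) := by
        rw [← hL.apply p q, ← hD.apply p q, h2 q p hq (not_lt.mp hp)]
        simp
      rw [if_neg hp, if_pos hq, e]; field_simp; ring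
    · rw [if_neg hp, if_neg hq, h0 p q (not_lt.mp hp) (not_lt.mp hq)]; ring
end

section
/- Let S = (1/3)·diag(1,1,1,0), S1 = (1/3)·[[1,0,0,0],[0,1,0,1/2],[0,0,−2,0],[0,1/2,0,0]] and S2 = (1/3)·[[0,1,0,0],[1,0,1,0],[0,1,0,−3/2],[0,0,−3/2,0]] be 4×4 complex matrices. Then for every e ∈ ℕ and all Hermitian (4+e)×(4+e) complex matrices 𝓛1, 𝓛2 satisfying S̃1 = (1/2)(S̃ 𝓛1 + 𝓛1 S̃) and S̃2 = (1/2)(S̃ 𝓛2 + 𝓛2 S̃), where S̃, S̃1, S̃2 are the zero-padded extensions of S, S1, S2 to size 4+e, one has 𝓛1 𝓛2 ≠ 𝓛2 𝓛1. -/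
open Matrix

/-- The zero-padded extension of a `d × d` matrix to size `d + e`. -/
def zeroPad {d : ℕ} (e : ℕ) (M : Matrix (Fin d) (Fin d) ℂ) :
    Matrix (Fin (d + e)) (Fin (d + e)) ℂ :=
  Matrix.of fun p q =>
    if h : (p : ℕ) < d ∧ (q : ℕ) < d then M ⟨p, h.1⟩ ⟨q, h.2⟩ else 0

/-- The padded state is diagonal. -/
lemma zeroPad_state (e : ℕ) :
    zeroPad e ((1 / 3 : ℂ) • !![1, 0, 0, 0; 0, 1, 0, 0; 0, 0, 1, 0; 0, 0, 0, 0]) =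
      Matrix.diagonal (fun p : Fin (4 + e) => if (p : ℕ) < 3 then (1 / 3 : ℂ) else 0) := by
  ext ⟨p, hp⟩ ⟨q, hq⟩
  by_cases h : p < 4 ∧ q < 4
  · obtain ⟨h1, h2⟩ := h
    interval_cases p <;> interval_cases q <;> simp [zeroPad, Matrix.diagonal]
  · simp only [zeroPad, Matrix.of_apply, Matrix.diagonal_apply, Fin.mk.injEq, dif_neg h]
    split_ifs <;> first | rfl | omega

/-- Entrywise form of the SLD equation. -/
lemma sld_entry {e : ℕ} {S M : Matrix (Fin 4) (Fin 4) ℂ}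
    {L : Matrix (Fin (4 + e)) (Fin (4 + e)) ℂ}
    (hS : S = (1 / 3 : ℂ) • !![1, 0, 0, 0; 0, 1, 0, 0; 0, 0, 1, 0; 0, 0, 0, 0])
    (h : zeroPad e M = (1 / 2 : ℂ) • (zeroPad e S * L + L * zeroPad e S))
    (k c : Fin (4 + e)) (hc : (c : ℕ) < 3) :
    L k c = (if (k : ℕ) < 3 then 3 else 6) * zeroPad e M k c := by
  rw [h, hS, zeroPad_state]
  simp only [Matrix.smul_apply, Matrix.add_apply, Matrix.diagonal_mul, Matrix.mul_diagonal,
    smul_eq_mul, if_pos hc]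
  split_ifs <;> ring

/-- Example A: for this rank-3 state in a 4-dimensional Hilbert space, no choice of SLD
operators on any extended Hilbert space commutes. -/
theorem exampleA_no_commuting_extension
    (S S1 S2 : Matrix (Fin 4) (Fin 4) ℂ)
    (hS : S = (1 / 3 : ℂ) • !![1, 0, 0, 0; 0, 1, 0, 0; 0, 0, 1, 0; 0, 0, 0, 0])
    (hS1 : S1 = (1 / 3 : ℂ) • !![1, 0, 0, 0; 0, 1, 0, 1/2; 0, 0, -2, 0; 0, 1/2, 0, 0])
    (hS2 : S2 = (1 / 3 : ℂ) • !![0, 1, 0, 0; 1, 0, 1, 0; 0, 1, 0, -3/2; 0, 0, -3/2, 0]) :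
    ∀ (e : ℕ) (L1 L2 : Matrix (Fin (4 + e)) (Fin (4 + e)) ℂ),
      L1.IsHermitian → L2.IsHermitian →
      zeroPad e S1 = (1 / 2 : ℂ) • (zeroPad e S * L1 + L1 * zeroPad e S) →
      zeroPad e S2 = (1 / 2 : ℂ) • (zeroPad e S * L2 + L2 * zeroPad e S) →
      L1 * L2 ≠ L2 * L1 := by
  intro e L1 L2 _ _ h1 h2 hcomm
  have E1 := sld_entry hS h1
  have E2 := sld_entry hS h2
  let i0 : Fin (4 + e) := ⟨0, by omega⟩
  let i1 : Fin (4 + e) := ⟨1, by omega⟩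
  let i3 : Fin (4 + e) := ⟨3, by omega⟩
  have c1 : ∀ k, L1 k i0 = if k = i0 then 1 else 0 := by
    rintro ⟨k, hk⟩
    rw [E1 _ _ (by simp [i0])]
    by_cases h : k < 4
    · interval_cases k <;> simp [zeroPad, hS1, i0]
    · have : k ≠ 0 := by omega
      simp [zeroPad, h, i0, this]
  have c2 : ∀ k, L2 k i0 = if k = i1 then 1 else 0 := by
    rintro ⟨k, hk⟩
    rw [E2 _ _ (by simp [i0])]
    by_cases h : k < 4
    · interval_cases k <;> simp [zeroPad, hS2, i0, i1]
    · have : k ≠ 1 := by omega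
      simp [zeroPad, h, i0, i1, this]
  have a : L1 i3 i1 = 1 := by
    rw [E1 _ _ (by simp [i1])]
    simp [zeroPad, hS1, i1, i3]
    norm_num
  have b : L2 i3 i0 = 0 := by
    rw [c2]
    simp [i1, i3]
  have := congrFun (congrFun hcomm i3) i0
  simp [Matrix.mul_apply, c1, c2, a] at this
  simp [i1, i3] at this
end

section
/- Let S = (1/3)·diag(1,1,1,0,0), S1 = (1/3)·[[1,0,0,1/2,0],[0,0,0,0,0],[0,0,−1,0,1/2],[1/2,0,0,0,0],[0,0,1/2,0,0]] and S2 = (1/3)·[[0,1,0,1/2,1/2],[1,0,1,−1/2,1/2],[0,1,0,1/2,−1/2],[1/2,−1/2,1/2,0,0],[1/2,1/2,−1/2,0,0]] be 5×5 complex matrices. Then for every e ∈ ℕ and all Hermitian (5+e)×(5+e) complex matrices 𝓛1, 𝓛2 satisfying S̃1 = (1/2)(S̃ 𝓛1 + 𝓛1 S̃) and S̃2 = (1/2)(S̃ 𝓛2 + 𝓛2 S̃), where S̃, S̃1, S̃2 are the zero-padded extensions of S, S1, S2 to size 5+e, one has 𝓛1 𝓛2 ≠ 𝓛2 𝓛1.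 -/
open Matrix

theorem zeroPad_cc {d : ℕ} (e : ℕ) (M : Matrix (Fin d) (Fin d) ℂ) (i j : Fin d) :
    zeroPad e M (Fin.castAdd e i) (Fin.castAdd e j) = M i j := by
  simp [zeroPad]

theorem zeroPad_cn {d : ℕ} (e : ℕ) (M : Matrix (Fin d) (Fin d) ℂ) (i : Fin d) (j : Fin e) :
    zeroPad e M (Fin.castAdd e i) (Fin.natAdd d j) = 0 := by
  simp [zeroPad]

theorem zeroPad_nc {d : ℕ} (e : ℕ) (M : Matrix (Fin d) (Fin d) ℂ) (i : Fin e) (j : Fin d) :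
    zeroPad e M (Fin.natAdd d i) (Fin.castAdd e j) = 0 := by
  simp [zeroPad]

theorem zeroPad_nn {d : ℕ} (e : ℕ) (M : Matrix (Fin d) (Fin d) ℂ) (i j : Fin e) :
    zeroPad e M (Fin.natAdd d i) (Fin.natAdd d j) = 0 := by
  simp [zeroPad]

theorem sld_entries (S D : Matrix (Fin 5) (Fin 5) ℂ)
    (hS : S = (1 / 3 : ℂ) • !![1, 0, 0, 0, 0; 0, 1, 0, 0, 0; 0, 0, 1, 0, 0;
      0, 0, 0, 0, 0; 0, 0, 0, 0, 0])
    (e : ℕ) (L : Matrix (Fin (5 + e)) (Fin (5 + e)) ℂ)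
    (h : zeroPad e D = (1 / 2 : ℂ) • (zeroPad e S * L + L * zeroPad e S)) :
    (∀ i j : Fin 5, D i j = (1 / 2 : ℂ) * ((S i i + S j j) *
      L (Fin.castAdd e i) (Fin.castAdd e j))) ∧
    (∀ (i : Fin 5) (k : Fin e), 0 = (1 / 2 : ℂ) * (S i i *
      L (Fin.castAdd e i) (Fin.natAdd 5 k))) := by
  constructor
  · intro i j
    have h1 := congrFun (congrFun h (Fin.castAdd e i)) (Fin.castAdd e j)
    simp only [zeroPad_cc, Matrix.smul_apply, Matrix.add_apply, Matrix.mul_apply,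
      Fin.sum_univ_add, zeroPad_cn, zeroPad_nc, zero_mul, mul_zero, Finset.sum_const_zero,
      add_zero, smul_eq_mul] at h1
    rw [h1]
    fin_cases i <;> fin_cases j <;> simp [hS, Fin.sum_univ_five] <;> ring
  · intro i k
    have h1 := congrFun (congrFun h (Fin.castAdd e i)) (Fin.natAdd 5 k)
    simp only [zeroPad_cc, Matrix.smul_apply, Matrix.add_apply, Matrix.mul_apply,
      Fin.sum_univ_add, zeroPad_cn, zeroPad_nn, zero_mul, mul_zero, Finset.sum_const_zero,
      add_zero, smul_eq_mul] at h1
    rw [h1]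
    fin_cases i <;> simp [hS, Fin.sum_univ_five]

set_option maxHeartbeats 1000000 in
theorem sld_fixed1 (S S1 : Matrix (Fin 5) (Fin 5) ℂ)
    (hS : S = (1 / 3 : ℂ) • !![1, 0, 0, 0, 0; 0, 1, 0, 0, 0; 0, 0, 1, 0, 0;
      0, 0, 0, 0, 0; 0, 0, 0, 0, 0])
    (hS1 : S1 = (1 / 3 : ℂ) • !![1, 0, 0, 1/2, 0; 0, 0, 0, 0, 0; 0, 0, -1, 0, 1/2;
      1/2, 0, 0, 0, 0; 0, 0, 1/2, 0, 0])
    (l : Fin 5 → Fin 5 → ℂ)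
    (a : ∀ i j : Fin 5, S1 i j = (1 / 2 : ℂ) * ((S i i + S j j) * l i j)) :
    ∀ i j : Fin 5, i < 3 ∨ j < 3 → l i j = (!![1, 0, 0, 1, 0; 0, 0, 0, 0, 0; 0, 0, -1, 0, 1; 1, 0, 0, 0, 0; 0, 0, 1, 0, 0] : Matrix (Fin 5) (Fin 5) ℂ) i j := by
  intro i j hij
  have key := a i j
  rw [hS, hS1] at key
  fin_cases i <;> fin_cases j <;> first
    | (exfalso; revert hij; decide)
    | (simp at key ⊢; done)
    | (simp at key ⊢; first | exact key | linear_combination (-3) * key | linear_combination (-6) * key)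

set_option maxHeartbeats 1000000 in
theorem sld_fixed2 (S S2 : Matrix (Fin 5) (Fin 5) ℂ)
    (hS : S = (1 / 3 : ℂ) • !![1, 0, 0, 0, 0; 0, 1, 0, 0, 0; 0, 0, 1, 0, 0;
      0, 0, 0, 0, 0; 0, 0, 0, 0, 0])
    (hS2 : S2 = (1 / 3 : ℂ) • !![0, 1, 0, 1/2, 1/2; 1, 0, 1, -1/2, 1/2;
      0, 1, 0, 1/2, -1/2; 1/2, -1/2, 1/2, 0, 0; 1/2, 1/2, -1/2, 0, 0])
    (l : Fin 5 → Fin 5 → ℂ)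
    (a : ∀ i j : Fin 5, S2 i j = (1 / 2 : ℂ) * ((S i i + S j j) * l i j)) :
    ∀ i j : Fin 5, i < 3 ∨ j < 3 → l i j = (!![0, 1, 0, 1, 1; 1, 0, 1, -1, 1; 0, 1, 0, 1, -1; 1, -1, 1, 0, 0; 1, 1, -1, 0, 0] : Matrix (Fin 5) (Fin 5) ℂ) i j := by
  intro i j hij
  have key := a i j
  rw [hS, hS2] at key
  fin_cases i <;> fin_cases j <;> first
    | (exfalso; revert hij; decide)
    | (simp at key ⊢; done)
    | (simp at key ⊢; first | exact key | linear_combination (-3) * key | linear_combination (-6) * key)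

/-- Example E: for this rank-3 state in a 5-dimensional Hilbert space, no choice of SLD
operators on any extended Hilbert space commutes. -/
theorem exampleE_no_commuting_extension
    (S S1 S2 : Matrix (Fin 5) (Fin 5) ℂ)
    (hS : S = (1 / 3 : ℂ) • !![1, 0, 0, 0, 0; 0, 1, 0, 0, 0; 0, 0, 1, 0, 0;
      0, 0, 0, 0, 0; 0, 0, 0, 0, 0])
    (hS1 : S1 = (1 / 3 : ℂ) • !![1, 0, 0, 1/2, 0; 0, 0, 0, 0, 0; 0, 0, -1, 0, 1/2;
      1/2, 0, 0, 0, 0; 0, 0, 1/2, 0, 0])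
    (hS2 : S2 = (1 / 3 : ℂ) • !![0, 1, 0, 1/2, 1/2; 1, 0, 1, -1/2, 1/2;
      0, 1, 0, 1/2, -1/2; 1/2, -1/2, 1/2, 0, 0; 1/2, 1/2, -1/2, 0, 0]) :
    ∀ (e : ℕ) (L1 L2 : Matrix (Fin (5 + e)) (Fin (5 + e)) ℂ),
      L1.IsHermitian → L2.IsHermitian →
      zeroPad e S1 = (1 / 2 : ℂ) • (zeroPad e S * L1 + L1 * zeroPad e S) →
      zeroPad e S2 = (1 / 2 : ℂ) • (zeroPad e S * L2 + L2 * zeroPad e S) →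
      L1 * L2 ≠ L2 * L1 := by
  intro e L1 L2 H1 H2 E1 E2 hc
  obtain ⟨a1, z1⟩ := sld_entries S S1 hS e L1 E1
  obtain ⟨a2, z2⟩ := sld_entries S S2 hS e L2 E2
  -- entries of the SLD operators that are fixed by the equations
  have s0 : S 0 0 = 1 / 3 := by simp [hS]
  have s1 : S 1 1 = 1 / 3 := by simp [hS]
  have s2 : S 2 2 = 1 / 3 := by simp [hS]
  have U1 := sld_fixed1 S S1 hS hS1 (fun i j => L1 (Fin.castAdd e i) (Fin.castAdd e j)) a1
  have U2 := sld_fixed2 S S2 hS hS2 (fun i j => L2 (Fin.castAdd e i) (Fin.castAdd e j)) a2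
  have u100 : L1 (Fin.castAdd e 0) (Fin.castAdd e 0) = 1 := U1 0 0 (by decide)
  have u101 : L1 (Fin.castAdd e 0) (Fin.castAdd e 1) = 0 := U1 0 1 (by decide)
  have u102 : L1 (Fin.castAdd e 0) (Fin.castAdd e 2) = 0 := U1 0 2 (by decide)
  have u103 : L1 (Fin.castAdd e 0) (Fin.castAdd e 3) = 1 := U1 0 3 (by decide)
  have u130 : L1 (Fin.castAdd e 3) (Fin.castAdd e 0) = 1 := U1 3 0 (by decide)
  have u104 : L1 (Fin.castAdd e 0) (Fin.castAdd e 4) = 0 := U1 0 4 (by decide)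
  have u140 : L1 (Fin.castAdd e 4) (Fin.castAdd e 0) = 0 := U1 4 0 (by decide)
  have u110 : L1 (Fin.castAdd e 1) (Fin.castAdd e 0) = 0 := U1 1 0 (by decide)
  have u111 : L1 (Fin.castAdd e 1) (Fin.castAdd e 1) = 0 := U1 1 1 (by decide)
  have u112 : L1 (Fin.castAdd e 1) (Fin.castAdd e 2) = 0 := U1 1 2 (by decide)
  have u113 : L1 (Fin.castAdd e 1) (Fin.castAdd e 3) = 0 := U1 1 3 (by decide)
  have u131 : L1 (Fin.castAdd e 3) (Fin.castAdd e 1) = 0 := U1 3 1 (by decide)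
  have u114 : L1 (Fin.castAdd e 1) (Fin.castAdd e 4) = 0 := U1 1 4 (by decide)
  have u141 : L1 (Fin.castAdd e 4) (Fin.castAdd e 1) = 0 := U1 4 1 (by decide)
  have u120 : L1 (Fin.castAdd e 2) (Fin.castAdd e 0) = 0 := U1 2 0 (by decide)
  have u121 : L1 (Fin.castAdd e 2) (Fin.castAdd e 1) = 0 := U1 2 1 (by decide)
  have u122 : L1 (Fin.castAdd e 2) (Fin.castAdd e 2) = -1 := U1 2 2 (by decide)
  have u123 : L1 (Fin.castAdd e 2) (Fin.castAdd e 3) = 0 := U1 2 3 (by decide)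
  have u132 : L1 (Fin.castAdd e 3) (Fin.castAdd e 2) = 0 := U1 3 2 (by decide)
  have u124 : L1 (Fin.castAdd e 2) (Fin.castAdd e 4) = 1 := U1 2 4 (by decide)
  have u142 : L1 (Fin.castAdd e 4) (Fin.castAdd e 2) = 1 := U1 4 2 (by decide)
  have w10 : ∀ k, L1 (Fin.castAdd e 0) (Fin.natAdd 5 k) = 0 := by
    intro k
    have := z1 0 k
    rw [s0] at this
    linear_combination (-6) * this
  have w11 : ∀ k, L1 (Fin.castAdd e 1) (Fin.natAdd 5 k) = 0 := by
    intro k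
    have := z1 1 k
    rw [s1] at this
    linear_combination (-6) * this
  have w12 : ∀ k, L1 (Fin.castAdd e 2) (Fin.natAdd 5 k) = 0 := by
    intro k
    have := z1 2 k
    rw [s2] at this
    linear_combination (-6) * this
  have u200 : L2 (Fin.castAdd e 0) (Fin.castAdd e 0) = 0 := U2 0 0 (by decide)
  have u201 : L2 (Fin.castAdd e 0) (Fin.castAdd e 1) = 1 := U2 0 1 (by decide)
  have u202 : L2 (Fin.castAdd e 0) (Fin.castAdd e 2) = 0 := U2 0 2 (by decide)
  have u203 : L2 (Fin.castAdd e 0) (Fin.castAdd e 3) = 1 := U2 0 3 (by decide)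
  have u230 : L2 (Fin.castAdd e 3) (Fin.castAdd e 0) = 1 := U2 3 0 (by decide)
  have u204 : L2 (Fin.castAdd e 0) (Fin.castAdd e 4) = 1 := U2 0 4 (by decide)
  have u240 : L2 (Fin.castAdd e 4) (Fin.castAdd e 0) = 1 := U2 4 0 (by decide)
  have u210 : L2 (Fin.castAdd e 1) (Fin.castAdd e 0) = 1 := U2 1 0 (by decide)
  have u211 : L2 (Fin.castAdd e 1) (Fin.castAdd e 1) = 0 := U2 1 1 (by decide)
  have u212 : L2 (Fin.castAdd e 1) (Fin.castAdd e 2) = 1 := U2 1 2 (by decide)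
  have u213 : L2 (Fin.castAdd e 1) (Fin.castAdd e 3) = -1 := U2 1 3 (by decide)
  have u231 : L2 (Fin.castAdd e 3) (Fin.castAdd e 1) = -1 := U2 3 1 (by decide)
  have u214 : L2 (Fin.castAdd e 1) (Fin.castAdd e 4) = 1 := U2 1 4 (by decide)
  have u241 : L2 (Fin.castAdd e 4) (Fin.castAdd e 1) = 1 := U2 4 1 (by decide)
  have u220 : L2 (Fin.castAdd e 2) (Fin.castAdd e 0) = 0 := U2 2 0 (by decide)
  have u221 : L2 (Fin.castAdd e 2) (Fin.castAdd e 1) = 1 := U2 2 1 (by decide)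
  have u222 : L2 (Fin.castAdd e 2) (Fin.castAdd e 2) = 0 := U2 2 2 (by decide)
  have u223 : L2 (Fin.castAdd e 2) (Fin.castAdd e 3) = 1 := U2 2 3 (by decide)
  have u232 : L2 (Fin.castAdd e 3) (Fin.castAdd e 2) = 1 := U2 3 2 (by decide)
  have u224 : L2 (Fin.castAdd e 2) (Fin.castAdd e 4) = -1 := U2 2 4 (by decide)
  have u242 : L2 (Fin.castAdd e 4) (Fin.castAdd e 2) = -1 := U2 4 2 (by decide)
  have w20 : ∀ k, L2 (Fin.castAdd e 0) (Fin.natAdd 5 k) = 0 := by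
    intro k
    have := z2 0 k
    rw [s0] at this
    linear_combination (-6) * this
  have w21 : ∀ k, L2 (Fin.castAdd e 1) (Fin.natAdd 5 k) = 0 := by
    intro k
    have := z2 1 k
    rw [s1] at this
    linear_combination (-6) * this
  have w22 : ∀ k, L2 (Fin.castAdd e 2) (Fin.natAdd 5 k) = 0 := by
    intro k
    have := z2 2 k
    rw [s2] at this
    linear_combination (-6) * this
  have cc : ∀ i j : Fin 5, _ := fun i j =>
    congrFun (congrFun hc (Fin.castAdd e i)) (Fin.castAdd e j)
  have cn : ∀ (i : Fin 5) (k : Fin e), _ := fun i k =>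
    congrFun (congrFun hc (Fin.castAdd e i)) (Fin.natAdd 5 k)
  simp only [Matrix.mul_apply, Fin.sum_univ_add, Fin.sum_univ_five] at cc cn
  have c03 := cc 0 3
  have c04 := cc 0 4
  have c13 := cc 1 3
  have c14 := cc 1 4
  have c23 := cc 2 3
  have c24 := cc 2 4
  have c33 := cc 3 4
  have n0 := cn 0
  have n1 := cn 1
  have n2 := cn 2
  simp only [u100, u101, u102, u103, u104, u110, u111, u112, u113, u114, u120, u121, u122,
    u123, u124, u130, u131, u132, u140, u141, u142, u200, u201, u202, u203, u204, u210, u211,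
    u212, u213, u214, u220, u221, u222, u223, u224, u230, u231, u232, u240, u241, u242, w10,
    w11, w12, w20, w21, w22, zero_mul, mul_zero, Finset.sum_const_zero, add_zero, zero_add,
    one_mul, mul_one] at c03 c04 c13 c14 c23 c24 c33 n0 n1 n2
  have b1 : ∀ k, L1 (Fin.castAdd e 4) (Fin.natAdd 5 k) =
      L1 (Fin.castAdd e 3) (Fin.natAdd 5 k) := fun k => by linear_combination -(n1 k)
  have b2 : ∀ k, L2 (Fin.castAdd e 3) (Fin.natAdd 5 k) =
      2 * L1 (Fin.castAdd e 3) (Fin.natAdd 5 k) := fun k => by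
    linear_combination n0 k + b1 k
  have b3 : ∀ k, L2 (Fin.castAdd e 4) (Fin.natAdd 5 k) = 0 := fun k => by
    linear_combination n2 k - b1 k
  have t1 : ∀ k, L1 (Fin.natAdd 5 k) (Fin.castAdd e 4) =
      star (L1 (Fin.castAdd e 3) (Fin.natAdd 5 k)) := fun k => by
    rw [← H1.apply, b1]
  have t2 : ∀ k, L2 (Fin.natAdd 5 k) (Fin.castAdd e 4) = 0 := fun k => by
    rw [← H2.apply, b3, star_zero]
  have h33 := H1.apply (Fin.castAdd e 3) (Fin.castAdd e 3)
  have h34 := H1.apply (Fin.castAdd e 3) (Fin.castAdd e 4)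
  have h44 := H1.apply (Fin.castAdd e 4) (Fin.castAdd e 4)
  have g34 := H2.apply (Fin.castAdd e 3) (Fin.castAdd e 4)
  simp only [b2, t1, t2, mul_zero, Finset.sum_const_zero, add_zero] at c33
  generalize L1 (Fin.castAdd e 3) (Fin.castAdd e 3) = p at *
  generalize L1 (Fin.castAdd e 3) (Fin.castAdd e 4) = q at *
  generalize L1 (Fin.castAdd e 4) (Fin.castAdd e 3) = q' at *
  generalize L1 (Fin.castAdd e 4) (Fin.castAdd e 4) = r at *
  generalize L2 (Fin.castAdd e 3) (Fin.castAdd e 3) = P at *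
  generalize L2 (Fin.castAdd e 3) (Fin.castAdd e 4) = Q at *
  generalize L2 (Fin.castAdd e 4) (Fin.castAdd e 3) = Q' at *
  generalize L2 (Fin.castAdd e 4) (Fin.castAdd e 4) = R at *
  have e1 : q' = p - 1 := by linear_combination -c13
  have e2 : q = r + 1 := by linear_combination c14
  have e3 : q = p - 1 := by
    rw [← h34, e1, star_sub, h33, star_one]
  have e4 : Q' = 2 := by linear_combination c23 - e1
  have e5 : Q = 2 := by rw [← g34, e4]; simp
  have e6 : q = 2 := by linear_combination (1 / 2) * (e5 - c04 + e2)
  have e7 : p = 3 := by linear_combination e6 - e3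
  have e8 : r = 1 := by linear_combination e6 - e2
  have e9 : P = 4 := by linear_combination c03 + e1 + 2 * e7
  have e10 : R = 0 := by linear_combination c24 + e6 - e8
  rw [e5, e6, e7, e8, e9, e10] at c33
  -- the extension contributes a nonnegative number, which cannot cancel the commutator
  have hre := congrArg Complex.re c33
  have hnn : 0 ≤ (∑ x, 2 * L1 (Fin.castAdd e 3) (Fin.natAdd 5 x) *
      star (L1 (Fin.castAdd e 3) (Fin.natAdd 5 x))).re := by
    rw [Complex.re_sum]
    refine Finset.sum_nonneg fun x _ => ?_
    rw [mul_assoc, Complex.star_def, Complex.mul_conj]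
    have := Complex.normSq_nonneg (L1 (Fin.castAdd e 3) (Fin.natAdd 5 x))
    simpa using this
  rw [Complex.add_re _ (∑ x, _)] at hre
  norm_num at hre hnn
  linarith
end

section
/- Let A = diag(1,0,−1) and B = [[0,1,0],[1,0,1],[0,1,0]] be 3×3 complex matrices, and let M1 = [[1,0],[0,0],[0,1]] and M2 = [[0,1],[−1,1],[1,0]] be 3×2 complex matrices. Then there do not exist Hermitian 2×2 complex matrices K1, K2 such that A·M2 − B·M1 + M1·K2 − M2·K1 = 0. -/
open Matrix

/-- Second example supporting Result A (Appendix D): no Hermitian kernel blocks `K1, K2`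
make the support–kernel block of the SLD commutator vanish. -/
theorem appendixD_no_kernel_blocks
    (A B : Matrix (Fin 3) (Fin 3) ℂ) (M1 M2 : Matrix (Fin 3) (Fin 2) ℂ)
    (hA : A = !![1, 0, 0; 0, 0, 0; 0, 0, -1])
    (hB : B = !![0, 1, 0; 1, 0, 1; 0, 1, 0])
    (hM1 : M1 = !![1, 0; 0, 0; 0, 1])
    (hM2 : M2 = !![0, 1; -1, 1; 1, 0]) :
    ¬ ∃ K1 K2 : Matrix (Fin 2) (Fin 2) ℂ, K1.IsHermitian ∧ K2.IsHermitian ∧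
      A * M2 - B * M1 + M1 * K2 - M2 * K1 = 0 := by
  rintro ⟨K1, K2, h1, h2, h⟩
  subst hA hB hM1 hM2
  have b := congrArg Complex.re (h1.apply 0 1)
  have q := congrArg Complex.re (h2.apply 0 1)
  have e01 := congrArg Complex.re (congrFun (congrFun h 0) 1)
  have e10 := congrArg Complex.re (congrFun (congrFun h 1) 0)
  have e11 := congrArg Complex.re (congrFun (congrFun h 1) 1)
  have e20 := congrArg Complex.re (congrFun (congrFun h 2) 0)
  simp [Matrix.vecHead, Matrix.vecTail, Matrix.vecMul, dotProduct, Fin.sum_univ_two] at b q e01 e10 e11 e20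
  linarith
end
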